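/- arXiv:1211.2496 — 2 statements merged into one kernel-verified Lean document; each statement's English description precedes it below -/
import Mathlib

section
/- Let R > 0 and let μ_R be the uniform probability measure on the half-disk D_R = {(x, y) ∈ ℝ² : x ≥ 0 and x² + y² ≤ R²}. Define g(r, x, y) = √((r − x)² + y²) − r. Then for every r ≥ R: −4R/(3π) = ∫ (−x) dμ_R(x, y) ≤ ∫ g(r, x, y) dμ_R(x, y) ≤ ∫ g(R, x, y) dμ_R(x, y) < −R/4. -/
open MeasureTheory Real

/-- The half-disk `D_R = {(x,y) : x ≥ 0, x² + y² ≤ R²}`. -/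
def halfDisk (R : ℝ) : Set (ℝ × ℝ) := {p | 0 ≤ p.1 ∧ p.1 ^ 2 + p.2 ^ 2 ≤ R ^ 2}

/-- The uniform probability measure on the half-disk of radius `R`. -/
noncomputable def halfDiskUnif (R : ℝ) : Measure (ℝ × ℝ) :=
  (ENNReal.ofReal (π * R ^ 2 / 2))⁻¹ • volume.restrict (halfDisk R)

/-- `g(r,x,y) = √((r-x)² + y²) - r`, the negative of the one-step progress. -/
noncomputable def gfun (r x y : ℝ) : ℝ := Real.sqrt ((r - x) ^ 2 + y ^ 2) - r

open Set intervalIntegral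

/-- Integration in polar coordinates over a set in the right half-plane that is star-shaped about
the origin with radial function `m`, of a function homogeneous of degree `k`. -/
theorem setIntegral_polar_of_homogeneous {A : Set (ℝ × ℝ)} (hA : MeasurableSet A)
    (hA_right : ∀ p ∈ A, 0 ≤ p.1) {f : ℝ × ℝ → ℝ} (hf : IntegrableOn f A) {h m : ℝ → ℝ} (k : ℕ)
    (hm : ∀ φ ∈ Icc (-(π / 2)) (π / 2), 0 ≤ m φ)
    (hmem : ∀ φ ∈ Icc (-(π / 2)) (π / 2), ∀ s > 0, (s * cos φ, s * sin φ) ∈ A ↔ s ≤ m φ)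
    (hfh : ∀ s > 0, ∀ φ, f (s * cos φ, s * sin φ) = s ^ k * h φ) :
    ∫ p in A, f p = ∫ φ in (-(π / 2))..(π / 2), h φ * m φ ^ (k + 2) / (k + 2) := by
  have hpi := Real.pi_pos
  have htarget : MeasurableSet polarCoord.target := polarCoord.open_target.measurableSet
  have hint : IntegrableOn (fun p : ℝ × ℝ => p.1 • A.indicator f (polarCoord.symm p))
      (Ioi (0 : ℝ) ×ˢ Ioo (-π) π) := by
    have hfA : IntegrableOn (A.indicator f) (polarCoord.symm '' polarCoord.target) :=
      ((integrable_indicator_iff hA).2 hf).integrableOn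
    rw [integrableOn_image_iff_integrableOn_abs_det_fderiv_smul volume htarget
      (fun p _ => (hasFDerivAt_polarCoord_symm p).hasFDerivWithinAt) polarCoord.symm.injOn] at hfA
    refine hfA.congr_fun (fun p hp => ?_) htarget
    have hp1 : 0 < p.1 := hp.1
    simp only [det_fderivPolarCoordSymm, abs_of_pos hp1]
  have houter : ∫ p in A, f p = ∫ φ in Ioo (-π) π, ∫ s in Ioi (0 : ℝ),
      s • A.indicator f (s * cos φ, s * sin φ) := by
    rw [← MeasureTheory.integral_indicator hA, ← integral_comp_polarCoord_symm, polarCoord_target]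
    rw [Measure.volume_eq_prod, IntegrableOn, ← Measure.prod_restrict] at hint
    rw [Measure.volume_eq_prod, ← Measure.prod_restrict, integral_prod_symm _ hint]
    rfl
  have hzero : ∀ φ ∈ Ioo (-π) π \ Icc (-(π / 2)) (π / 2), ∫ s in Ioi (0 : ℝ),
      s • A.indicator f (s * cos φ, s * sin φ) = 0 := by
    intro φ hφ
    have hcos : cos φ < 0 := by
      rw [← Real.cos_abs]
      have habs : π / 2 < |φ| := by
        by_contra! hle
        exact hφ.2 (abs_le.1 hle)
      have habs' : |φ| < π := abs_lt.2 hφ.1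
      exact Real.cos_neg_of_pi_div_two_lt_of_lt habs (by linarith)
    refine setIntegral_eq_zero_of_forall_eq_zero fun s hs => ?_
    have hs : 0 < s := hs
    rw [indicator_of_notMem, smul_zero]
    intro hmemA
    have := hA_right _ hmemA
    simp only at this
    nlinarith
  have hinner : ∀ φ ∈ Icc (-(π / 2)) (π / 2), ∫ s in Ioi (0 : ℝ),
      s • A.indicator f (s * cos φ, s * sin φ) = h φ * m φ ^ (k + 2) / (k + 2) := by
    intro φ hφ
    have hpt : ∀ s ∈ Ioi (0 : ℝ), s • A.indicator f (s * cos φ, s * sin φ)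
        = (Iic (m φ)).indicator (fun s => s ^ (k + 1) * h φ) s := by
      intro s hs
      by_cases hsm : s ≤ m φ
      · rw [indicator_of_mem ((hmem φ hφ s hs).2 hsm), indicator_of_mem (mem_Iic.2 hsm),
          hfh s hs φ, smul_eq_mul]
        ring
      · rw [indicator_of_notMem (fun hc => hsm ((hmem φ hφ s hs).1 hc)),
          indicator_of_notMem (notMem_Iic.2 (not_le.1 hsm)), smul_zero]
    rw [setIntegral_congr_fun measurableSet_Ioi hpt, setIntegral_indicator measurableSet_Iic,
      Ioi_inter_Iic, ← integral_of_le (hm φ hφ), intervalIntegral.integral_mul_const,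
      integral_pow]
    push_cast
    ring
  rw [houter, integral_of_le (by linarith), ← integral_Icc_eq_integral_Ioc,
    setIntegral_eq_of_subset_of_forall_sdiff_eq_zero measurableSet_Ioo
      (fun φ hφ => ⟨by linarith [hφ.1], by linarith [hφ.2]⟩) hzero]
  exact setIntegral_congr_fun measurableSet_Icc hinner

theorem isCompact_halfDisk (R : ℝ) : IsCompact (halfDisk R) := by
  refine Metric.isCompact_of_isClosed_isBounded ?_ ?_
  · exact (isClosed_le continuous_const continuous_fst).inter
      (isClosed_le ((continuous_fst.pow 2).add (continuous_snd.pow 2)) continuous_const)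
  · refine (Metric.isBounded_closedBall (x := (0 : ℝ × ℝ)) (r := |R|)).subset fun p hp => ?_
    rw [mem_closedBall_zero_iff, Prod.norm_def]
    exact max_le (sq_le_sq.1 (by nlinarith [hp.2, sq_nonneg p.2]))
      (sq_le_sq.1 (by nlinarith [hp.2, sq_nonneg p.1]))

theorem polar_mem_halfDisk_iff {R : ℝ} (hR : 0 < R) {φ : ℝ}
    (hφ : φ ∈ Icc (-(π / 2)) (π / 2)) {s : ℝ} (hs : 0 < s) :
    (s * cos φ, s * sin φ) ∈ halfDisk R ↔ s ≤ R := by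
  have hsq : (s * cos φ) ^ 2 + (s * sin φ) ^ 2 = s ^ 2 := by
    linear_combination s ^ 2 * Real.cos_sq_add_sin_sq φ
  have hcos := mul_nonneg hs.le (Real.cos_nonneg_of_mem_Icc hφ)
  simp only [halfDisk, mem_ofPred_eq, hsq, hcos, true_and]
  exact pow_le_pow_iff_left₀ hs.le hR.le two_ne_zero

theorem volume_real_halfDisk {R : ℝ} (hR : 0 < R) :
    volume.real (halfDisk R) = π * R ^ 2 / 2 := by
  have harea := setIntegral_polar_of_homogeneous (isCompact_halfDisk R).measurableSet
    (fun p hp => hp.1) (f := fun _ => 1) (h := fun _ => 1) (m := fun _ => R)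
    (continuousOn_const.integrableOn_compact (isCompact_halfDisk R)) 0 (fun _ _ => hR.le)
    (fun φ hφ s hs => polar_mem_halfDisk_iff hR hφ hs) (by simp)
  simp only [setIntegral_const, intervalIntegral.integral_const, smul_eq_mul] at harea
  push_cast at harea
  linarith

theorem setIntegral_fst_halfDisk {R : ℝ} (hR : 0 < R) :
    ∫ p in halfDisk R, p.1 = 2 * R ^ 3 / 3 := by
  rw [setIntegral_polar_of_homogeneous (isCompact_halfDisk R).measurableSet
    (fun p hp => hp.1) (h := cos) (m := fun _ => R)
    (continuous_fst.continuousOn.integrableOn_compact (isCompact_halfDisk R)) 1 (fun _ _ => hR.le)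
    (fun φ hφ s hs => polar_mem_halfDisk_iff hR hφ hs) (by simp)]
  rw [intervalIntegral.integral_div, intervalIntegral.integral_mul_const, integral_cos,
    Real.sin_neg, Real.sin_pi_div_two]
  push_cast
  ring

theorem integral_inv_cos_cube :
    ∫ φ in (-(π / 4))..(π / 4), (1 / cos φ) ^ 3 = √2 + log (1 + √2) := by
  have hcos : ∀ φ ∈ uIcc (-(π / 4)) (π / 4), 0 < cos φ := by
    intro φ hφ
    rw [uIcc_of_le (by linarith [Real.pi_pos])] at hφ
    exact Real.cos_pos_of_mem_Ioo
      ⟨by linarith [hφ.1, Real.pi_pos], by linarith [hφ.2, Real.pi_pos]⟩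
  have hderiv : ∀ φ ∈ uIcc (-(π / 4)) (π / 4), HasDerivAt
      (fun φ => (sin φ / cos φ ^ 2 + (log (1 + sin φ) - log (1 - sin φ)) / 2) / 2)
      ((1 / cos φ) ^ 3) φ := by
    intro φ hφ
    have hc := hcos φ hφ
    have hsq := Real.sin_sq_add_cos_sq φ
    have hplus : 0 < 1 + sin φ := by nlinarith
    have hminus : 0 < 1 - sin φ := by nlinarith
    convert! ((((Real.hasDerivAt_sin φ).div ((Real.hasDerivAt_cos φ).fun_pow 2)
      (pow_pos hc 2).ne').add
      (((((Real.hasDerivAt_sin φ).const_add 1).log hplus.ne').sub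
        (((Real.hasDerivAt_sin φ).const_sub 1).log hminus.ne')).div_const 2)).div_const 2) using 1
    have hfrac : cos φ / (1 + sin φ) - -cos φ / (1 - sin φ) = 2 / cos φ := by
      field_simp
      linear_combination 2 * hsq
    rw [hfrac]
    push_cast
    field_simp
    linear_combination (-2) * hsq
  have hcont : ContinuousOn (fun φ => (1 / cos φ) ^ 3) (uIcc (-(π / 4)) (π / 4)) :=
    (continuousOn_const.div Real.continuous_cos.continuousOn fun φ hφ => (hcos φ hφ).ne').pow 3
  rw [integral_eq_sub_of_hasDerivAt hderiv hcont.intervalIntegrable]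
  have hsqrt : √2 ^ 2 = 2 := Real.sq_sqrt (by norm_num)
  have hsqrt_pos : 0 < √2 := by positivity
  have hsqrt_lt : √2 < 2 := by nlinarith
  have hlog : log (1 + √2 / 2) = log (1 - √2 / 2) + 2 * log (1 + √2) := by
    have hfactor : 1 + √2 / 2 = (1 - √2 / 2) * (1 + √2) ^ 2 := by
      linear_combination (√2 / 2) * hsqrt
    rw [hfactor, Real.log_mul (by linarith) (by positivity), Real.log_pow]
    norm_num
  simp only [Real.sin_neg, Real.cos_neg, Real.sin_pi_div_four, Real.cos_pi_div_four,
    sub_neg_eq_add, ← sub_eq_add_neg, hlog]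
  field_simp
  linear_combination (-4) * hsqrt

theorem hasDerivAt_sin_sub_sin_cube_div_three (φ : ℝ) :
    HasDerivAt (fun φ => sin φ - sin φ ^ 3 / 3) (cos φ ^ 3) φ := by
  convert! (Real.hasDerivAt_sin φ).sub (((Real.hasDerivAt_sin φ).pow 3).div_const 3) using 1
  push_cast
  linear_combination cos φ * Real.sin_sq_add_cos_sq φ

theorem integral_cos_cube_pi_div_four_pi_div_two :
    ∫ φ in (π / 4)..(π / 2), cos φ ^ 3 = 2 / 3 - 5 * √2 / 12 := by
  rw [integral_eq_sub_of_hasDerivAt (fun φ _ => hasDerivAt_sin_sub_sin_cube_div_three φ)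
    ((Real.continuous_cos.pow 3).intervalIntegrable _ _), Real.sin_pi_div_two,
    Real.sin_pi_div_four]
  have hsqrt : √2 ^ 2 = 2 := Real.sq_sqrt (by norm_num)
  linear_combination (√2 / 24) * hsqrt

/-- The radial function, as seen from `(1, 0)`, of the unit half-disk. -/
noncomputable def halfDiskRadius (φ : ℝ) : ℝ := min (2 * cos φ) (1 / cos φ)

theorem halfDiskRadius_of_abs_le {φ : ℝ} (hφ : |φ| ≤ π / 4) :
    halfDiskRadius φ = 1 / cos φ := by
  have hcos : √2 / 2 ≤ cos φ := by
    rw [← Real.cos_pi_div_four, ← Real.cos_abs φ]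
    exact Real.cos_le_cos_of_nonneg_of_le_pi (abs_nonneg _) (by linarith [Real.pi_pos]) hφ
  have hsqrt : √2 ^ 2 = 2 := Real.sq_sqrt (by norm_num)
  have hsqrt_pos : 0 < √2 := by positivity
  refine min_eq_right ?_
  rw [div_le_iff₀ (by linarith)]
  nlinarith

theorem halfDiskRadius_of_le_abs {φ : ℝ} (hφ : π / 4 ≤ |φ|) (hφ' : |φ| ≤ π / 2) :
    halfDiskRadius φ = 2 * cos φ := by
  have hcos : cos φ ≤ √2 / 2 := by
    rw [← Real.cos_pi_div_four, ← Real.cos_abs φ]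
    exact Real.cos_le_cos_of_nonneg_of_le_pi (by positivity) (by linarith [Real.pi_pos]) hφ
  have hcos_nonneg : 0 ≤ cos φ := Real.cos_nonneg_of_mem_Icc (abs_le.1 hφ')
  have hsqrt : √2 ^ 2 = 2 := Real.sq_sqrt (by norm_num)
  refine min_eq_left ?_
  rcases hcos_nonneg.eq_or_lt with h0 | hpos
  · simp [← h0]
  · rw [le_div_iff₀ hpos]
    nlinarith

theorem integral_halfDiskRadius_cube :
    ∫ φ in (-(π / 2))..(π / 2), halfDiskRadius φ ^ 3
      = log (1 + √2) + 32 / 3 - 17 * √2 / 3 := by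
  have hpi := Real.pi_pos
  have hleft : EqOn (fun φ => halfDiskRadius φ ^ 3) (fun φ => 8 * cos φ ^ 3)
      (uIcc (-(π / 2)) (-(π / 4))) := by
    intro φ hφ
    rw [uIcc_of_le (by linarith)] at hφ
    have habs : |φ| = -φ := abs_of_nonpos (by linarith [hφ.2])
    simp only
    rw [halfDiskRadius_of_le_abs (by linarith [hφ.2]) (by linarith [hφ.1])]
    ring
  have hmid : EqOn (fun φ => halfDiskRadius φ ^ 3) (fun φ => (1 / cos φ) ^ 3)
      (uIcc (-(π / 4)) (π / 4)) := by
    intro φ hφ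
    rw [uIcc_of_le (by linarith)] at hφ
    simp only
    rw [halfDiskRadius_of_abs_le (abs_le.2 hφ)]
  have hright : EqOn (fun φ => halfDiskRadius φ ^ 3) (fun φ => 8 * cos φ ^ 3)
      (uIcc (π / 4) (π / 2)) := by
    intro φ hφ
    rw [uIcc_of_le (by linarith)] at hφ
    have habs : |φ| = φ := abs_of_nonneg (by linarith [hφ.1])
    simp only
    rw [halfDiskRadius_of_le_abs (by linarith [hφ.1]) (by linarith [hφ.2])]
    ring
  have hcos_cont : Continuous fun φ => 8 * cos φ ^ 3 := by fun_prop
  have hinv_cont : ContinuousOn (fun φ => (1 / cos φ) ^ 3) (uIcc (-(π / 4)) (π / 4)) := by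
    refine (continuousOn_const.div Real.continuous_cos.continuousOn fun φ hφ => ?_).pow 3
    rw [uIcc_of_le (by linarith)] at hφ
    exact (Real.cos_pos_of_mem_Ioo ⟨by linarith [hφ.1], by linarith [hφ.2]⟩).ne'
  have hleft_int : IntervalIntegrable (fun φ => halfDiskRadius φ ^ 3) volume
      (-(π / 2)) (-(π / 4)) := (hcos_cont.continuousOn.congr hleft).intervalIntegrable
  have hmid_int : IntervalIntegrable (fun φ => halfDiskRadius φ ^ 3) volume
      (-(π / 4)) (π / 4) := (hinv_cont.congr hmid).intervalIntegrable
  have hright_int : IntervalIntegrable (fun φ => halfDiskRadius φ ^ 3) volume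
      (π / 4) (π / 2) := (hcos_cont.continuousOn.congr hright).intervalIntegrable
  have hreflect : ∫ φ in (-(π / 2))..(-(π / 4)), cos φ ^ 3
      = ∫ φ in (π / 4)..(π / 2), cos φ ^ 3 := by
    rw [← integral_comp_neg]
    simp
  rw [← integral_add_adjacent_intervals (hleft_int.trans hmid_int) hright_int,
    ← integral_add_adjacent_intervals hleft_int hmid_int, integral_congr hleft,
    integral_congr hmid, integral_congr hright, intervalIntegral.integral_const_mul,
    intervalIntegral.integral_const_mul, hreflect, integral_inv_cos_cube,
    integral_cos_cube_pi_div_four_pi_div_two]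
  ring

theorem polar_mem_reflected_halfDisk_iff {R : ℝ} (hR : 0 < R) {φ : ℝ}
    (hφ : φ ∈ Icc (-(π / 2)) (π / 2)) {s : ℝ} (hs : 0 < s) :
    (R, (0 : ℝ)) - (s * cos φ, s * sin φ) ∈ halfDisk R ↔ s ≤ R * halfDiskRadius φ := by
  have hcos := Real.cos_nonneg_of_mem_Icc hφ
  have hsq : (R - s * cos φ) ^ 2 + (0 - s * sin φ) ^ 2 - R ^ 2 = s * (s - 2 * R * cos φ) := by
    linear_combination s ^ 2 * Real.cos_sq_add_sin_sq φ
  have hdisk : (R - s * cos φ) ^ 2 + (0 - s * sin φ) ^ 2 ≤ R ^ 2 ↔ s ≤ R * (2 * cos φ) := by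
    rw [← sub_nonpos, hsq, mul_nonpos_iff_pos_imp_nonpos]
    constructor
    · intro hle
      linarith [hle.1 hs]
    · intro hle
      exact ⟨fun _ => by linarith, fun _ => hs.le⟩
  rw [halfDiskRadius, mul_min_of_nonneg _ _ hR.le, le_min_iff, ← hdisk]
  simp only [halfDisk, mem_ofPred_eq, Prod.mk_sub_mk, and_comm (a := 0 ≤ R - s * cos φ)]
  refine and_congr_right fun hle => ?_
  have hpos : 0 < cos φ := by
    rcases hcos.eq_or_lt with h0 | hpos
    · have := hdisk.1 hle
      rw [← h0] at this
      linarith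
    · exact hpos
  rw [mul_one_div, le_div_iff₀ hpos, sub_nonneg]

theorem setIntegral_dist_halfDisk {R : ℝ} (hR : 0 < R) :
    ∫ p in halfDisk R, √((R - p.1) ^ 2 + p.2 ^ 2)
      = R ^ 3 / 3 * (log (1 + √2) + 32 / 3 - 17 * √2 / 3) := by
  set e := Homeomorph.subLeft ((R, 0) : ℝ × ℝ)
  have hcompact : IsCompact (e ⁻¹' halfDisk R) :=
    e.isCompact_preimage.2 (isCompact_halfDisk R)
  have hshift : ∫ p in halfDisk R, √((R - p.1) ^ 2 + p.2 ^ 2)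
      = ∫ p in e ⁻¹' halfDisk R, √(p.1 ^ 2 + p.2 ^ 2) := by
    rw [← (Measure.measurePreserving_sub_left volume ((R, 0) : ℝ × ℝ)).setIntegral_preimage_emb
      e.measurableEmbedding]
    simp [e]
  rw [hshift, setIntegral_polar_of_homogeneous hcompact.measurableSet
    (fun p hp => ?_) (h := fun _ => 1) (m := fun φ => R * halfDiskRadius φ)
    (Continuous.continuousOn (by fun_prop) |>.integrableOn_compact hcompact) 1
    (fun φ hφ => ?_) (fun φ hφ s hs => polar_mem_reflected_halfDisk_iff hR hφ hs)
    (fun s hs φ => ?_)]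
  · rw [← integral_halfDiskRadius_cube, ← intervalIntegral.integral_const_mul]
    congr 1
    ext φ
    push_cast
    ring
  · have hle : (R - p.1) ^ 2 + (0 - p.2) ^ 2 ≤ R ^ 2 := hp.2
    nlinarith [sq_nonneg p.1, sq_nonneg p.2]
  · have hcos := Real.cos_nonneg_of_mem_Icc hφ
    exact mul_nonneg hR.le (le_min (by positivity) (by positivity))
  · have hsq : (s * cos φ) ^ 2 + (s * sin φ) ^ 2 = s ^ 2 := by
      linear_combination s ^ 2 * Real.cos_sq_add_sin_sq φ
    simp only [hsq, Real.sqrt_sq hs.le]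
    ring

theorem log_one_add_sqrt_two_lt : log (1 + √2) < 0.88145 := by
  have hsqrt : √2 < 1.41422 := by
    rw [Real.sqrt_lt' (by norm_num)]
    norm_num
  rw [Real.log_lt_iff_lt_exp (by positivity)]
  have hexp := Real.sum_le_exp_of_nonneg (x := 0.88145) (by norm_num) 9
  norm_num [Finset.sum_range_succ, Nat.factorial] at hexp ⊢
  linarith

theorem integral_halfDiskUnif {R : ℝ} (hR : 0 < R) (f : ℝ × ℝ → ℝ) :
    ∫ p, f p ∂(halfDiskUnif R) = (π * R ^ 2 / 2)⁻¹ * ∫ p in halfDisk R, f p := by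
  rw [halfDiskUnif, MeasureTheory.integral_smul_measure, ENNReal.toReal_inv,
    ENNReal.toReal_ofReal (by positivity), smul_eq_mul]

theorem integrable_halfDiskUnif {R : ℝ} (hR : 0 < R) {f : ℝ × ℝ → ℝ} (hf : Continuous f) :
    Integrable f (halfDiskUnif R) :=
  Integrable.smul_measure (hf.continuousOn.integrableOn_compact (isCompact_halfDisk R))
    (ENNReal.inv_ne_top.2 (ENNReal.ofReal_pos.2 (by positivity)).ne')

theorem continuous_gfun (r : ℝ) : Continuous fun p : ℝ × ℝ => gfun r p.1 p.2 := by
  unfold gfun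
  fun_prop

theorem neg_le_gfun (r x y : ℝ) : -x ≤ gfun r x y := by
  have : r - x ≤ √((r - x) ^ 2 + y ^ 2) := Real.le_sqrt_of_sq_le (by nlinarith [sq_nonneg y])
  unfold gfun
  linarith

theorem antitone_gfun (x y : ℝ) : Antitone fun r => gfun r x y := by
  intro R r hr
  have hle : √((r - x) ^ 2 + y ^ 2) ≤ √((R - x) ^ 2 + y ^ 2) + (r - R) := by
    have habs : R - x ≤ √((R - x) ^ 2 + y ^ 2) :=
      Real.le_sqrt_of_sq_le (by nlinarith [sq_nonneg y])
    have hsq : √((R - x) ^ 2 + y ^ 2) ^ 2 = (R - x) ^ 2 + y ^ 2 := Real.sq_sqrt (by positivity)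
    have hnonneg := Real.sqrt_nonneg ((R - x) ^ 2 + y ^ 2)
    rw [Real.sqrt_le_left (by linarith)]
    nlinarith [mul_nonneg (sub_nonneg.2 hr) (sub_nonneg.2 habs)]
  simp only [gfun]
  linarith

theorem integral_gfun_lt {R : ℝ} (hR : 0 < R) :
    ∫ p : ℝ × ℝ, gfun R p.1 p.2 ∂(halfDiskUnif R) < -R / 4 := by
  have hset : ∫ p in halfDisk R, gfun R p.1 p.2
      = R ^ 3 / 3 * (log (1 + √2) + 32 / 3 - 17 * √2 / 3) - π * R ^ 2 / 2 * R := by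
    simp only [gfun]
    rw [MeasureTheory.integral_sub
      (Continuous.continuousOn (by fun_prop) |>.integrableOn_compact (isCompact_halfDisk R))
      (continuousOn_const.integrableOn_compact (isCompact_halfDisk R)),
      setIntegral_dist_halfDisk hR, setIntegral_const, volume_real_halfDisk hR, smul_eq_mul]
  have hsqrt : 1.41421 < √2 := by
    rw [Real.lt_sqrt (by norm_num)]
    norm_num
  have hconst : (log (1 + √2) + 32 / 3 - 17 * √2 / 3) / 3 < 3 * π / 8 := by
    linarith [log_one_add_sqrt_two_lt, Real.pi_gt_d6]
  rw [integral_halfDiskUnif hR, hset, inv_mul_lt_iff₀ (by positivity)]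
  linarith [mul_lt_mul_of_pos_left hconst (pow_pos hR 3)]

/-- For every `r ≥ R`:
`-4R/(3π) = ∫(-x) dμ_R ≤ ∫ g(r,x,y) dμ_R ≤ ∫ g(R,x,y) dμ_R < -R/4`. -/
theorem expected_progress_bounds (R : ℝ) (hR : 0 < R) (r : ℝ) (hr : R ≤ r) :
    -(4 * R) / (3 * π) = (∫ p : ℝ × ℝ, -p.1 ∂(halfDiskUnif R)) ∧
    (∫ p : ℝ × ℝ, -p.1 ∂(halfDiskUnif R))
      ≤ (∫ p : ℝ × ℝ, gfun r p.1 p.2 ∂(halfDiskUnif R)) ∧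
    (∫ p : ℝ × ℝ, gfun r p.1 p.2 ∂(halfDiskUnif R))
      ≤ (∫ p : ℝ × ℝ, gfun R p.1 p.2 ∂(halfDiskUnif R)) ∧
    (∫ p : ℝ × ℝ, gfun R p.1 p.2 ∂(halfDiskUnif R)) < -R / 4 := by
  refine ⟨?_, ?_, ?_, integral_gfun_lt hR⟩
  · rw [integral_halfDiskUnif hR, MeasureTheory.integral_neg, setIntegral_fst_halfDisk hR]
    field_simp
    ring
  · exact integral_mono (integrable_halfDiskUnif hR continuous_fst.neg)
      (integrable_halfDiskUnif hR (continuous_gfun r)) fun p => neg_le_gfun r p.1 p.2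
  · exact integral_mono (integrable_halfDiskUnif hR (continuous_gfun r))
      (integrable_halfDiskUnif hR (continuous_gfun R)) fun p => antitone_gfun p.1 p.2 hr
end

section
/- Let p, q, s > 0 be real numbers. Then Σ_{n=0}^∞ Σ_{m=1}^∞ (n/(n + m)) · (q^m / m!) e^{−q} · ((p + s) e^{−(p+s)} / (1 − e^{−(p+s)})) · (p^n / n!) · ∫₀¹ y^n e^{s y} dy = ((p + s) e^{−(p+q+s)} / (1 − e^{−(p+s)})) · ∫₀¹ ∫₀¹ p y e^{p y w + s y} (e^{q w} − 1) dw dy. -/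
open Real

/-- Termwise integration over `[0, 1]` of a series of continuous functions dominated by a summable
sequence of constants. -/
lemma hasSum_integral_unitInterval {F : ℕ → ℝ → ℝ} {f : ℝ → ℝ} {c : ℕ → ℝ}
    (hF : ∀ n, Continuous (F n)) (hc : Summable c)
    (hb : ∀ n, ∀ t ∈ Set.Icc (0 : ℝ) 1, |F n t| ≤ c n)
    (hf : ∀ t ∈ Set.Icc (0 : ℝ) 1, HasSum (fun n => F n t) (f t)) :
    HasSum (fun n => ∫ t in (0 : ℝ)..1, F n t) (∫ t in (0 : ℝ)..1, f t) := by
  have hmem : ∀ t ∈ Set.uIoc (0 : ℝ) 1, t ∈ Set.Icc (0 : ℝ) 1 := fun t ht => by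
    rw [Set.uIoc_of_le zero_le_one] at ht
    exact Set.Ioc_subset_Icc_self ht
  refine intervalIntegral.hasSum_integral_of_dominated_convergence (fun n _ => c n)
    (fun n => (hF n).aestronglyMeasurable) (fun n => ?_) ?_ ?_ ?_
  · exact Filter.Eventually.of_forall fun t ht => hb n t (hmem t ht)
  · exact Filter.Eventually.of_forall fun _ _ => hc
  · exact intervalIntegrable_const
  · exact Filter.Eventually.of_forall fun t ht => hf t (hmem t ht)

lemma hasSum_pow_div_factorial (x : ℝ) :
    HasSum (fun n : ℕ => x ^ n / Nat.factorial n) (Real.exp x) := by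
  rw [Real.exp_eq_exp_ℝ]
  exact NormedSpace.expSeries_div_hasSum_exp x

lemma hasSum_pow_succ_div_factorial (x : ℝ) :
    HasSum (fun m : ℕ => x ^ (m + 1) / Nat.factorial (m + 1)) (Real.exp x - 1) := by
  simpa using (hasSum_nat_add_iff' 1).2 (hasSum_pow_div_factorial x)

/-- The derivative in `w` of the exponential series of `x * w`. -/
lemma hasSum_nat_mul_pow_pred (x w : ℝ) :
    HasSum (fun n : ℕ => n * w ^ (n - 1) * (x ^ n / Nat.factorial n)) (x * Real.exp (x * w)) := by
  rw [← hasSum_nat_add_iff' 1]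
  simp only [Finset.range_one, Finset.sum_singleton, Nat.cast_zero, zero_mul, sub_zero]
  refine HasSum.congr_fun ((hasSum_pow_div_factorial (x * w)).mul_left x) fun n => ?_
  rw [Nat.factorial_succ, Nat.add_sub_cancel, mul_pow]
  push_cast
  field_simp
  ring

/-- The integral weight `∫₀¹ n wⁿ⁻¹ (e^{qw} - 1) dw` attached to the index `n`. -/
noncomputable def expWeight (q : ℝ) (n : ℕ) : ℝ :=
  ∫ w in (0 : ℝ)..1, n * w ^ (n - 1) * (Real.exp (q * w) - 1)

lemma integral_nat_mul_pow_pred_mul_pow (n m : ℕ) (a : ℝ) :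
    ∫ w in (0 : ℝ)..1, n * w ^ (n - 1) * (a * w ^ (m + 1)) = n / (n + (m + 1)) * a := by
  rcases n with _ | n
  · simp
  · have h : ∀ w : ℝ, ((n + 1 : ℕ) : ℝ) * w ^ (n + 1 - 1) * (a * w ^ (m + 1))
        = ((n + 1 : ℕ) * a) * w ^ (n + m + 1) := fun w => by
      rw [Nat.add_sub_cancel]; ring
    simp_rw [h, intervalIntegral.integral_const_mul, integral_pow]
    push_cast
    simp only [one_pow, ne_eq, Nat.add_eq_zero_iff, one_ne_zero, and_false, not_false_eq_true,
      zero_pow, sub_zero]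
    rw [show (n : ℝ) + 1 + (m + 1) = n + m + 1 + 1 by ring]
    ring

lemma hasSum_expWeight {q : ℝ} (hq : 0 ≤ q) (n : ℕ) :
    HasSum (fun m : ℕ => (n : ℝ) / (n + (m + 1)) * (q ^ (m + 1) / Nat.factorial (m + 1)))
      (expWeight q n) := by
  have key := hasSum_integral_unitInterval
    (F := fun m w => n * w ^ (n - 1) * (q ^ (m + 1) / Nat.factorial (m + 1) * w ^ (m + 1)))
    (f := fun w => n * w ^ (n - 1) * (Real.exp (q * w) - 1))
    (fun m => by fun_prop) ((hasSum_pow_succ_div_factorial q).summable.mul_left (n : ℝ)) ?_ ?_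
  · simpa only [integral_nat_mul_pow_pred_mul_pow, expWeight] using key
  · rintro m w ⟨h0, h1⟩
    rw [abs_of_nonneg (by positivity)]
    exact mul_le_mul (mul_le_of_le_one_right (by positivity) (pow_le_one₀ h0 h1))
      (mul_le_of_le_one_right (by positivity) (pow_le_one₀ h0 h1)) (by positivity) (by positivity)
  · intro w _
    refine HasSum.mul_left _ ?_
    refine HasSum.congr_fun (hasSum_pow_succ_div_factorial (q * w)) fun m => ?_
    rw [mul_pow]; ring

lemma expWeight_nonneg {q : ℝ} (hq : 0 ≤ q) (n : ℕ) : 0 ≤ expWeight q n :=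
  (hasSum_expWeight hq n).nonneg fun m => by positivity

lemma expWeight_le {q : ℝ} (hq : 0 ≤ q) (n : ℕ) : expWeight q n ≤ Real.exp q - 1 :=
  hasSum_le (fun m => mul_le_of_le_one_left (by positivity)
      (div_le_one_of_le₀ (by linarith [(m.cast_nonneg : (0 : ℝ) ≤ m)]) (by positivity)))
    (hasSum_expWeight hq n) (hasSum_pow_succ_div_factorial q)

lemma hasSum_expWeight_mul_pow {q x : ℝ} (hq : 0 ≤ q) (hx : 0 ≤ x) :
    HasSum (fun n : ℕ => expWeight q n * (x ^ n / Nat.factorial n))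
      (∫ w in (0 : ℝ)..1, x * Real.exp (x * w) * (Real.exp (q * w) - 1)) := by
  have key := hasSum_integral_unitInterval
    (F := fun n w => n * w ^ (n - 1) * (Real.exp (q * w) - 1) * (x ^ n / Nat.factorial n))
    (f := fun w => x * Real.exp (x * w) * (Real.exp (q * w) - 1))
    (fun n => by fun_prop)
    ((hasSum_nat_mul_pow_pred x 1).summable.mul_right (Real.exp q - 1)) ?_ ?_
  · simpa only [intervalIntegral.integral_mul_const, expWeight] using key
  · rintro n w ⟨h0, h1⟩
    have hw : 0 ≤ Real.exp (q * w) - 1 := sub_nonneg.2 (Real.one_le_exp (by positivity))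
    have hle : Real.exp (q * w) ≤ Real.exp q :=
      Real.exp_le_exp.2 (mul_le_of_le_one_right hq h1)
    rw [abs_of_nonneg (by positivity), one_pow, mul_right_comm]
    gcongr
    exact pow_le_one₀ h0 h1
  · intro w _
    simpa only [mul_right_comm] using
      (hasSum_nat_mul_pow_pred x w).mul_right (Real.exp (q * w) - 1)

lemma hasSum_expWeight_mul_integral {p q s : ℝ} (hp : 0 ≤ p) (hq : 0 ≤ q) (hs : 0 ≤ s) :
    HasSum (fun n : ℕ => expWeight q n * (p ^ n / Nat.factorial n)
        * ∫ y in (0 : ℝ)..1, y ^ n * Real.exp (s * y))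
      (∫ y in (0 : ℝ)..1, ∫ w in (0 : ℝ)..1,
        p * y * Real.exp (p * y * w + s * y) * (Real.exp (q * w) - 1)) := by
  simp only [← intervalIntegral.integral_const_mul]
  refine hasSum_integral_unitInterval
    (c := fun n => (Real.exp q - 1) * (p ^ n / Nat.factorial n) * Real.exp s)
    (fun n => by fun_prop)
    (((hasSum_pow_div_factorial p).summable.mul_left _).mul_right _) ?_ ?_
  · rintro n y ⟨h0, h1⟩
    have hA := expWeight_nonneg hq n
    have hle : y ^ n * Real.exp (s * y) ≤ Real.exp s :=
      (mul_le_of_le_one_left (by positivity) (pow_le_one₀ h0 h1)).trans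
        (Real.exp_le_exp.2 (mul_le_of_le_one_right hs h1))
    rw [abs_of_nonneg (by positivity)]
    exact mul_le_mul (mul_le_mul_of_nonneg_right (expWeight_le hq n) (by positivity)) hle
      (by positivity) (mul_nonneg (hA.trans (expWeight_le hq n)) (by positivity))
  · rintro y ⟨h0, -⟩
    have h := (hasSum_expWeight_mul_pow hq (mul_nonneg hp h0)).mul_right (Real.exp (s * y))
    have hint : ∫ w in (0 : ℝ)..1, p * y * Real.exp (p * y * w + s * y) * (Real.exp (q * w) - 1)
        = (∫ w in (0 : ℝ)..1, p * y * Real.exp (p * y * w) * (Real.exp (q * w) - 1))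
          * Real.exp (s * y) := by
      rw [← intervalIntegral.integral_mul_const]
      refine intervalIntegral.integral_congr fun w _ => ?_
      simp only [Real.exp_add]
      ring
    rw [hint]
    refine HasSum.congr_fun h fun n => ?_
    rw [mul_pow]; ring

/-- The double-series expression for `E[φ'(CD)/φ'(C); φ'(C)>0 | φ(D)>0]` equals the
double-integral expression, where `p = λ|C∩D|`, `q = λ|C∩Dᶜ|`, `s = λ|Cᶜ∩D|`. -/
theorem markov_expectation_integral_form (p q s : ℝ) (hp : 0 < p) (hq : 0 < q)
    (hs : 0 < s) :
    (∑' n : ℕ, ∑' m : ℕ,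
        ((n : ℝ) / (n + (m + 1))) * (q ^ (m + 1) / Nat.factorial (m + 1)) * Real.exp (-q)
          * ((p + s) * Real.exp (-(p + s)) / (1 - Real.exp (-(p + s))))
          * (p ^ n / Nat.factorial n)
          * ∫ y in (0 : ℝ)..1, y ^ n * Real.exp (s * y))
      = ((p + s) * Real.exp (-(p + q + s)) / (1 - Real.exp (-(p + s))))
          * ∫ y in (0 : ℝ)..1, ∫ w in (0 : ℝ)..1,
              p * y * Real.exp (p * y * w + s * y) * (Real.exp (q * w) - 1) := by
  set K := (p + s) * Real.exp (-(p + s)) / (1 - Real.exp (-(p + s))) with hK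
  have hconst : (p + s) * Real.exp (-(p + q + s)) / (1 - Real.exp (-(p + s)))
      = Real.exp (-q) * K := by
    rw [hK, show -(p + q + s) = -q + -(p + s) by ring, Real.exp_add]
    ring
  rw [hconst, ← (hasSum_expWeight_mul_integral hp.le hq.le hs.le).tsum_eq, ← tsum_mul_left]
  refine tsum_congr fun n => ?_
  simp only [tsum_mul_right, (hasSum_expWeight hq.le n).tsum_eq]
  ring
end
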